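/- arXiv:math/0702896 — 5 statements merged into one kernel-verified Lean document; each statement's English description precedes it below -/
import Mathlib

section
/- The Clifford algebra Cl(3,0) is isomorphic as an ℝ-algebra to the tensor product ℂ ⊗_ℝ ℍ of the complex numbers with the quaternions. -/
open Quaternion Matrix TensorProduct

/-- The quadratic form of signature `(p,q)` on `ℝⁿ`, `n = p + q`. -/
noncomputable def Qpq (p q : ℕ) : QuadraticForm ℝ (Fin (p + q) → ℝ) :=
  QuadraticMap.weightedSumSquares ℝ (fun i : Fin (p + q) => if (i : ℕ) < p then (1 : ℝ) else -1)

set_option linter.unusedSimpArgs false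
set_option linter.unusedSectionVars false

namespace Cl30

section Generic
variable {A : Type*} [Ring A] [Algebra ℝ A] {a b c : A}

/-- The relations satisfied by the three generators. -/
structure Rel (a b c : A) : Prop where
  aa : a * a = 1
  bb : b * b = 1
  cc : c * c = 1
  ba : b * a = -(a * b)
  ca : c * a = -(a * c)
  cb : c * b = -(b * c)

theorem Rel.aa_mul (h : Rel a b c) (x : A) : a * (a * x) = x := by rw [← mul_assoc, h.aa, one_mul]
theorem Rel.bb_mul (h : Rel a b c) (x : A) : b * (b * x) = x := by rw [← mul_assoc, h.bb, one_mul]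
theorem Rel.cc_mul (h : Rel a b c) (x : A) : c * (c * x) = x := by rw [← mul_assoc, h.cc, one_mul]
theorem Rel.ba_mul (h : Rel a b c) (x : A) : b * (a * x) = -(a * (b * x)) := by
  rw [← mul_assoc, h.ba, neg_mul, mul_assoc]
theorem Rel.ca_mul (h : Rel a b c) (x : A) : c * (a * x) = -(a * (c * x)) := by
  rw [← mul_assoc, h.ca, neg_mul, mul_assoc]
theorem Rel.cb_mul (h : Rel a b c) (x : A) : c * (b * x) = -(b * (c * x)) := by
  rw [← mul_assoc, h.cb, neg_mul, mul_assoc]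

theorem Rel.omega_sq (h : Rel a b c) : (a * b * c) * (a * b * c) = -1 := by
  simp [mul_assoc, h.aa, h.bb, h.cc, h.ba, h.ca, h.cb, h.aa_mul, h.bb_mul, h.cc_mul, h.ba_mul, h.ca_mul, h.cb_mul]

/-- The quaternion basis given by the bivectors. -/
def Rel.basis (h : Rel a b c) : QuaternionAlgebra.Basis A (-1 : ℝ) 0 (-1) where
  i := -(b * c)
  j := a * c
  k := -(a * b)
  i_mul_i := by
    simp [mul_assoc, h.aa, h.bb, h.cc, h.ba, h.ca, h.cb, h.aa_mul, h.bb_mul, h.cc_mul, h.ba_mul, h.ca_mul, h.cb_mul]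
  j_mul_j := by
    simp [mul_assoc, h.aa, h.bb, h.cc, h.ba, h.ca, h.cb, h.aa_mul, h.bb_mul, h.cc_mul, h.ba_mul, h.ca_mul, h.cb_mul]
  i_mul_j := by
    simp [mul_assoc, h.aa, h.bb, h.cc, h.ba, h.ca, h.cb, h.aa_mul, h.bb_mul, h.cc_mul, h.ba_mul, h.ca_mul, h.cb_mul]
  j_mul_i := by
    simp [mul_assoc, h.aa, h.bb, h.cc, h.ba, h.ca, h.cb, h.aa_mul, h.bb_mul, h.cc_mul, h.ba_mul, h.ca_mul, h.cb_mul]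

theorem Rel.comm_i (h : Rel a b c) : Commute (a * b * c) (-(b * c)) := by
  simp [Commute, SemiconjBy, mul_assoc, h.aa, h.bb, h.cc, h.ba, h.ca, h.cb, h.aa_mul, h.bb_mul, h.cc_mul,
    h.ba_mul, h.ca_mul, h.cb_mul]
theorem Rel.comm_j (h : Rel a b c) : Commute (a * b * c) (a * c) := by
  simp [Commute, SemiconjBy, mul_assoc, h.aa, h.bb, h.cc, h.ba, h.ca, h.cb, h.aa_mul, h.bb_mul, h.cc_mul,
    h.ba_mul, h.ca_mul, h.cb_mul]
theorem Rel.comm_k (h : Rel a b c) : Commute (a * b * c) (-(a * b)) := by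
  simp [Commute, SemiconjBy, mul_assoc, h.aa, h.bb, h.cc, h.ba, h.ca, h.cb, h.aa_mul, h.bb_mul, h.cc_mul,
    h.ba_mul, h.ca_mul, h.cb_mul]

/-- The algebra map out of the tensor product. -/
noncomputable def Rel.hom (h : Rel a b c) : ℂ ⊗[ℝ] ℍ[ℝ] →ₐ[ℝ] A :=
  Algebra.TensorProduct.lift (Complex.lift ⟨a * b * c, h.omega_sq⟩) h.basis.liftHom (by
    intro z q
    suffices H : Commute (algebraMap ℝ A z.re + z.im • (a * b * c)) (algebraMap ℝ A q.re
        + q.imI • (-(b * c)) + q.imJ • (a * c) + q.imK • (-(a * b))) from H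
    refine Commute.add_left (Algebra.commutes _ _) (Commute.smul_left ?_ _)
    exact (((Algebra.commute_algebraMap_right _ _).add_right (h.comm_i.smul_right _)).add_right
      (h.comm_j.smul_right _)).add_right (h.comm_k.smul_right _))

theorem Rel.hom_tmul (h : Rel a b c) (z : ℂ) (q : ℍ[ℝ]) : h.hom (z ⊗ₜ q) =
    (algebraMap ℝ A z.re + z.im • (a * b * c)) * (algebraMap ℝ A q.re + q.imI • (-(b * c))
      + q.imJ • (a * c) + q.imK • (-(a * b))) := rfl

end Generic

theorem Q_apply (v : Fin (3 + 0) → ℝ) : Qpq 3 0 v = v 0 * v 0 + v 1 * v 1 + v 2 * v 2 := by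
  simp [Qpq, QuadraticMap.weightedSumSquares_apply, Fin.sum_univ_three]

/-- The generators. -/
noncomputable def e (i : Fin (3 + 0)) : CliffordAlgebra (Qpq 3 0) :=
  CliffordAlgebra.ι (Qpq 3 0) (Pi.single i 1)

theorem e_sq (i : Fin (3 + 0)) : e i * e i = 1 := by
  rw [e, CliffordAlgebra.ι_sq_scalar, Q_apply]
  fin_cases i <;> simp [Pi.single_apply]

theorem e_anti (i j : Fin (3 + 0)) (hij : i ≠ j) : e i * e j = -(e j * e i) := by
  rw [eq_neg_iff_add_eq_zero, e, e, CliffordAlgebra.ι_mul_ι_add_swap, QuadraticMap.polar]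
  simp only [Q_apply]
  fin_cases i <;> fin_cases j <;> simp_all [Pi.single_apply]

theorem rel : Rel (e 0) (e 1) (e 2) :=
  ⟨e_sq _, e_sq _, e_sq _, e_anti _ _ (by decide), e_anti _ _ (by decide), e_anti _ _ (by decide)⟩

/-- Constructor for quaternions. -/
def q4 (a b c d : ℝ) : ℍ[ℝ] := ⟨a, b, c, d⟩
@[simp] theorem q4_re (a b c d : ℝ) : (q4 a b c d).re = a := rfl
@[simp] theorem q4_imI (a b c d : ℝ) : (q4 a b c d).imI = b := rfl
@[simp] theorem q4_imJ (a b c d : ℝ) : (q4 a b c d).imJ = c := rfl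
@[simp] theorem q4_imK (a b c d : ℝ) : (q4 a b c d).imK = d := rfl

theorem quat_ext {A : Type*} [Ring A] [Algebra ℝ A] (f g : ℍ[ℝ] →ₐ[ℝ] A)
    (hi : f (q4 0 1 0 0) = g (q4 0 1 0 0)) (hj : f (q4 0 0 1 0) = g (q4 0 0 1 0)) : f = g :=
  @QuaternionAlgebra.hom_ext ℝ A _ _ _ (-1) 0 (-1) f g hi hj

/-- Imaginary quaternions from vectors. -/
noncomputable def vec : (Fin (3 + 0) → ℝ) →ₗ[ℝ] ℍ[ℝ] where
  toFun v := q4 0 (v 0) (v 1) (v 2)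
  map_add' v w := by ext <;> simp
  map_smul' r v := by ext <;> simp

theorem vec_apply (v) : vec v = q4 0 (v 0) (v 1) (v 2) := rfl

theorem vec_sq (v) : vec v * vec v = algebraMap ℝ _ (-Qpq 3 0 v) := by
  rw [Q_apply]
  ext <;> simp [vec_apply] <;> ring

/-- The forward map. -/
noncomputable def fwd : CliffordAlgebra (Qpq 3 0) →ₐ[ℝ] ℂ ⊗[ℝ] ℍ[ℝ] :=
  CliffordAlgebra.lift (Qpq 3 0) ⟨(TensorProduct.mk ℝ ℂ ℍ[ℝ] Complex.I).comp vec, fun v => by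
    simp only [LinearMap.comp_apply, TensorProduct.mk_apply, Algebra.TensorProduct.tmul_mul_tmul,
      vec_sq, Complex.I_mul_I]
    rw [map_neg, TensorProduct.tmul_neg, TensorProduct.neg_tmul, neg_neg,
      Algebra.algebraMap_eq_smul_one, TensorProduct.tmul_smul, Algebra.algebraMap_eq_smul_one]
    rfl⟩

theorem fwd_e (i) : fwd (e i) = Complex.I ⊗ₜ vec (Pi.single i 1) := by
  exact CliffordAlgebra.lift_ι_apply _ _ _

theorem bwd_fwd : rel.hom.comp fwd = AlgHom.id ℝ _ := by
  ext i
  have h := rel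
  change rel.hom (fwd (e i)) = e i
  rw [fwd_e, h.hom_tmul]
  fin_cases i <;> simp [vec_apply, Pi.single_apply, mul_assoc, h.aa, h.bb, h.cc, h.ba, h.ca, h.cb, h.aa_mul,
    h.bb_mul, h.cc_mul, h.ba_mul, h.ca_mul, h.cb_mul]

theorem fwd_bwd : fwd.comp rel.hom = AlgHom.id ℝ _ := by
  apply Algebra.TensorProduct.ext
  · apply Complex.algHom_ext
    have : rel.hom (Complex.I ⊗ₜ 1) = e 0 * e 1 * e 2 := by
      rw [rel.hom_tmul]; simp
    simp only [AlgHom.comp_apply, Algebra.TensorProduct.includeLeft_apply, AlgHom.id_apply, this,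
      map_mul, fwd_e, Algebra.TensorProduct.tmul_mul_tmul]
    have h2 : vec (Pi.single 0 1) * vec (Pi.single 1 1) * vec (Pi.single 2 1) = -1 := by
      ext <;> simp [vec_apply, Pi.single_apply]
    rw [h2]
    simp [TensorProduct.tmul_neg, TensorProduct.neg_tmul]
  · refine quat_ext (A := ℂ ⊗[ℝ] ℍ[ℝ]) _ _ ?_ ?_
    · have : rel.hom (1 ⊗ₜ (q4 0 1 0 0)) = -(e 1 * e 2) := by
        rw [rel.hom_tmul]; simp
      change fwd (rel.hom (1 ⊗ₜ (q4 0 1 0 0))) = 1 ⊗ₜ (q4 0 1 0 0)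
      rw [this]
      simp only [map_neg, map_mul, fwd_e, Algebra.TensorProduct.tmul_mul_tmul, Complex.I_mul_I]
      rw [TensorProduct.neg_tmul, neg_neg]
      congr 1
      ext <;> simp [vec_apply, Pi.single_apply]
    · have : rel.hom (1 ⊗ₜ (q4 0 0 1 0)) = e 0 * e 2 := by
        rw [rel.hom_tmul]; simp
      change fwd (rel.hom (1 ⊗ₜ (q4 0 0 1 0))) = 1 ⊗ₜ (q4 0 0 1 0)
      rw [this]
      simp only [map_mul, fwd_e, Algebra.TensorProduct.tmul_mul_tmul, Complex.I_mul_I]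
      rw [TensorProduct.neg_tmul, ← TensorProduct.tmul_neg]
      congr 1
      ext <;> simp [vec_apply, Pi.single_apply]

end Cl30

/-- The Clifford algebra `Cl(3,0)` is isomorphic as an ℝ-algebra to `ℂ ⊗_ℝ ℍ`. -/
theorem cl30_iso_complex_tensor_quaternions :
    Nonempty (CliffordAlgebra (Qpq 3 0) ≃ₐ[ℝ] (ℂ ⊗[ℝ] ℍ[ℝ])) :=
  ⟨AlgEquiv.ofAlgHom Cl30.fwd Cl30.rel.hom Cl30.fwd_bwd Cl30.bwd_fwd⟩
end

section
/- There exists an injective ℝ-algebra homomorphism Φ_C : Cl(3,1) → M₄(ℂ) such that Φ_C(ι(v_0)) = B₁, Φ_C(ι(v_1)) = B₂, Φ_C(ι(v_2)) = B₃, Φ_C(ι(v_3)) = B₄, where B₁ = [[0,0,0,1],[0,0,1,0],[0,1,0,0],[1,0,0,0]], B₂ = [[0,0,0,−i],[0,0,i,0],[0,−i,0,0],[i,0,0,0]], B₃ = [[0,0,1,0],[0,0,0,−1],[1,0,0,0],[0,−1,0,0]], B₄ = [[0,0,1,0],[0,0,0,1],[−1,0,0,0],[0,−1,0,0]]. (This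 identifies Cl(3,1) with an algebra of endomorphisms of the space ℂ⁴ of Dirac spinors.) -/
open Matrix CliffordAlgebra

namespace Cl31Aux

/-- `S + e S`. -/
def ext {A : Type*} [Ring A] [Algebra ℝ A] (e : A) (S : Submodule ℝ A) : Submodule ℝ A :=
  S ⊔ S.map (LinearMap.mulLeft ℝ e)

variable {A : Type*} [Ring A] [Algebra ℝ A]

lemma mem_ext {e : A} {S : Submodule ℝ A} {x : A} :
    x ∈ ext e S ↔ ∃ a ∈ S, ∃ b ∈ S, x = a + e * b := by
  simp only [ext, Submodule.mem_sup, Submodule.mem_map, LinearMap.mulLeft_apply]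
  constructor
  · rintro ⟨a, ha, _, ⟨b, hb, rfl⟩, rfl⟩
    exact ⟨a, ha, b, hb, rfl⟩
  · rintro ⟨a, ha, b, hb, rfl⟩
    exact ⟨a, ha, _, ⟨b, hb, rfl⟩, rfl⟩

lemma ext_self {e : A} {S : Submodule ℝ A} (r : ℝ) (he : e * e = algebraMap ℝ A r) :
    ∀ x ∈ ext e S, e * x ∈ ext e S := by
  intro x hx
  obtain ⟨a, ha, b, hb, rfl⟩ := mem_ext.1 hx
  refine mem_ext.2 ⟨r • b, S.smul_mem r hb, a, ha, ?_⟩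
  rw [mul_add, ← mul_assoc, he, Algebra.smul_def, add_comm]

lemma ext_other {e f : A} {S : Submodule ℝ A} (hf : ∀ x ∈ S, f * x ∈ S)
    (he : f * e = - (e * f)) : ∀ x ∈ ext e S, f * x ∈ ext e S := by
  intro x hx
  obtain ⟨a, ha, b, hb, rfl⟩ := mem_ext.1 hx
  refine mem_ext.2 ⟨f * a, hf a ha, -(f * b), S.neg_mem (hf b hb), ?_⟩
  rw [mul_add, ← mul_assoc, he, neg_mul, mul_neg, mul_assoc]

lemma one_mem_ext {e : A} {S : Submodule ℝ A} (h : 1 ∈ S) : 1 ∈ ext e S :=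
  Submodule.mem_sup_left h

/-- generators -/
noncomputable def e (i : Fin (3 + 1)) : CliffordAlgebra (Qpq 3 1) :=
  CliffordAlgebra.ι (Qpq 3 1) (Pi.single i 1)

lemma Q_apply (v : Fin (3 + 1) → ℝ) :
    Qpq 3 1 v = v 0 * v 0 + v 1 * v 1 + v 2 * v 2 - v 3 * v 3 := by
  have h := Fin.sum_univ_four (fun i : Fin 4 =>
    (if (i : ℕ) < 3 then (1 : ℝ) else -1) • (v i * v i))
  rw [Qpq, QuadraticMap.weightedSumSquares_apply]
  refine h.trans ?_
  simp
  ring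

lemma e_sq (i : Fin (3 + 1)) : e i * e i = algebraMap ℝ _ (Qpq 3 1 (Pi.single i 1)) :=
  CliffordAlgebra.ι_sq_scalar _ _

lemma e_anti {i j : Fin (3 + 1)} (h : i ≠ j) : e i * e j = -(e j * e i) := by
  rw [eq_neg_iff_add_eq_zero]
  unfold e
  rw [CliffordAlgebra.ι_mul_ι_add_swap, QuadraticMap.polar]
  simp only [Q_apply]
  rw [← map_zero (algebraMap ℝ (CliffordAlgebra (Qpq 3 1)))]
  congr 1
  revert h
  fin_cases i <;> fin_cases j <;> simp

/-- the span of all ordered products -/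
noncomputable def T : Submodule ℝ (CliffordAlgebra (Qpq 3 1)) :=
  ext (e 0) (ext (e 1) (ext (e 2) (ext (e 3) (Submodule.span ℝ {1}))))

lemma e_mul_T (i : Fin (3 + 1)) : ∀ x ∈ T, e i * x ∈ T := by
  unfold T
  fin_cases i
  · exact ext_self _ (e_sq 0)
  · exact ext_other (ext_self _ (e_sq 1)) (e_anti (by decide))
  · exact ext_other (ext_other (ext_self _ (e_sq 2)) (e_anti (by decide))) (e_anti (by decide))
  · exact ext_other (ext_other (ext_other (ext_self _ (e_sq 3)) (e_anti (by decide)))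
      (e_anti (by decide))) (e_anti (by decide))

lemma ι_eq (v : Fin (3 + 1) → ℝ) : CliffordAlgebra.ι (Qpq 3 1) v = ∑ i, v i • e i := by
  conv_lhs => rw [pi_eq_sum_univ' v]
  simp only [map_sum, map_smul]
  rfl

lemma mem_T (x : CliffordAlgebra (Qpq 3 1)) : x ∈ T := by
  have h1 : (1 : CliffordAlgebra (Qpq 3 1)) ∈ T :=
    one_mem_ext (one_mem_ext (one_mem_ext (one_mem_ext (Submodule.mem_span_singleton_self 1))))
  induction x using CliffordAlgebra.left_induction with
  | algebraMap r => rw [Algebra.algebraMap_eq_smul_one]; exact T.smul_mem r h1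
  | add x y hx hy => exact T.add_mem hx hy
  | ι_mul x m hx =>
    rw [ι_eq, Finset.sum_mul]
    refine T.sum_mem fun i _ => ?_
    rw [smul_mul_assoc]
    exact T.smul_mem _ (e_mul_T i x hx)

/-- the matrix of a vector -/
noncomputable def f : (Fin (3 + 1) → ℝ) →ₗ[ℝ] Matrix (Fin 4) (Fin 4) ℂ where
  toFun v := !![0, 0, v 2 + v 3, v 0 - v 1 * Complex.I;
    0, 0, v 0 + v 1 * Complex.I, - v 2 + v 3;
    v 2 - v 3, v 0 - v 1 * Complex.I, 0, 0;
    v 0 + v 1 * Complex.I, - v 2 - v 3, 0, 0]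
  map_add' v w := by
    ext i j
    fin_cases i <;> fin_cases j <;> simp <;> ring
  map_smul' r v := by
    ext i j
    fin_cases i <;> fin_cases j <;> simp <;> ring

lemma f_sq (v : Fin (3 + 1) → ℝ) : f v * f v = algebraMap ℝ _ (Qpq 3 1 v) := by
  have hI := Complex.I_sq
  rw [Q_apply]
  ext i j
  fin_cases i <;> fin_cases j <;>
    simp [f, Matrix.mul_apply, Fin.sum_univ_four, Matrix.algebraMap_matrix_apply] <;> grind

/-- the homomorphism -/
noncomputable def Φ : CliffordAlgebra (Qpq 3 1) →ₐ[ℝ] Matrix (Fin 4) (Fin 4) ℂ :=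
  CliffordAlgebra.lift (Qpq 3 1) ⟨f, f_sq⟩

lemma Φ_ι (v : Fin (3 + 1) → ℝ) : Φ (CliffordAlgebra.ι (Qpq 3 1) v) = f v := by
  simp [Φ]

lemma Φ0 : Φ (e 0) = !![0, 0, 0, 1; 0, 0, 1, 0; 0, 1, 0, 0; 1, 0, 0, 0] := by
  rw [e, Φ_ι]; ext i j; fin_cases i <;> fin_cases j <;> simp [f]

lemma Φ1 : Φ (e 1) = !![0, 0, 0, -Complex.I; 0, 0, Complex.I, 0;
           0, -Complex.I, 0, 0; Complex.I, 0, 0, 0] := by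
  rw [e, Φ_ι]; ext i j; fin_cases i <;> fin_cases j <;> simp [f]

lemma Φ2 : Φ (e 2) = !![0, 0, 1, 0; 0, 0, 0, -1; 1, 0, 0, 0; 0, -1, 0, 0] := by
  rw [e, Φ_ι]; ext i j; fin_cases i <;> fin_cases j <;> simp [f]

lemma Φ3 : Φ (e 3) = !![0, 0, 1, 0; 0, 0, 0, 1; -1, 0, 0, 0; 0, -1, 0, 0] := by
  rw [e, Φ_ι]; ext i j; fin_cases i <;> fin_cases j <;> simp [f]

lemma mem_ext3 {x : CliffordAlgebra (Qpq 3 1)} (h : x ∈ ext (e 3) (Submodule.span ℝ {1})) :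
    ∃ a b : ℝ, x = a • 1 + e 3 * b • 1 := by
  obtain ⟨a, ha, b, hb, rfl⟩ := mem_ext.1 h
  obtain ⟨a, rfl⟩ := Submodule.mem_span_singleton.1 ha
  obtain ⟨b, rfl⟩ := Submodule.mem_span_singleton.1 hb
  exact ⟨a, b, rfl⟩

lemma mem_ext2 {x : CliffordAlgebra (Qpq 3 1)}
    (h : x ∈ ext (e 2) (ext (e 3) (Submodule.span ℝ {1}))) :
    ∃ a b c d : ℝ, x = (a • 1 + e 3 * b • 1) + e 2 * (c • 1 + e 3 * d • 1) := by
  obtain ⟨a, ha, b, hb, rfl⟩ := mem_ext.1 h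
  obtain ⟨a, b, rfl⟩ := mem_ext3 ha
  obtain ⟨c, d, rfl⟩ := mem_ext3 hb
  exact ⟨a, b, c, d, rfl⟩

lemma Φ_23 (a b c d : ℝ) : Φ ((a • 1 + e 3 * b • 1) + e 2 * (c • 1 + e 3 * d • 1)) =
    !![(a - d : ℂ), 0, b + c, 0; 0, a + d * (1 : ℂ), 0, b - c;
      c - b, 0, a + d, 0; 0, -b - c, 0, a - d] := by
  simp only [map_add, map_mul, map_smul, map_one, Φ2, Φ3, mul_add, mul_smul_comm, mul_one]
  ext i j
  simp only [Matrix.add_apply, Matrix.smul_apply, Matrix.mul_apply, Fin.sum_univ_four,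
    Matrix.one_apply]
  fin_cases i <;> fin_cases j <;>
    simp <;> ring

lemma Φ_inj : Function.Injective Φ := by
  rw [injective_iff_map_eq_zero]
  intro x hx
  obtain ⟨y, hy, z, hz, rfl⟩ := mem_ext.1 (mem_T x)
  obtain ⟨p, hp, q, hq, rfl⟩ := mem_ext.1 hy
  obtain ⟨r, hr, s, hs, rfl⟩ := mem_ext.1 hz
  simp only [map_add, map_mul] at hx
  obtain ⟨p0, p1, p2, p3, rfl⟩ := mem_ext2 hp
  obtain ⟨q0, q1, q2, q3, rfl⟩ := mem_ext2 hq
  obtain ⟨r0, r1, r2, r3, rfl⟩ := mem_ext2 hr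
  obtain ⟨s0, s1, s2, s3, rfl⟩ := mem_ext2 hs
  rw [Φ_23, Φ_23, Φ_23, Φ_23, Φ0, Φ1] at hx
  have H := fun i j => congrFun (congrFun hx i) j
  simp only [Fin.forall_fin_succ, Matrix.add_apply, Matrix.mul_apply, Fin.sum_univ_four] at H
  simp [Complex.ext_iff] at H
  have hp0 : p0 = 0 := by linarith
  have hp1 : p1 = 0 := by linarith
  have hp2 : p2 = 0 := by linarith
  have hp3 : p3 = 0 := by linarith
  have hq0 : q0 = 0 := by linarith
  have hq1 : q1 = 0 := by linarith
  have hq2 : q2 = 0 := by linarith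
  have hq3 : q3 = 0 := by linarith
  have hr0 : r0 = 0 := by linarith
  have hr1 : r1 = 0 := by linarith
  have hr2 : r2 = 0 := by linarith
  have hr3 : r3 = 0 := by linarith
  have hs0 : s0 = 0 := by linarith
  have hs1 : s1 = 0 := by linarith
  have hs2 : s2 = 0 := by linarith
  have hs3 : s3 = 0 := by linarith
  simp [hp0, hp1, hp2, hp3, hq0, hq1, hq2, hq3, hr0, hr1, hr2, hr3, hs0, hs1, hs2, hs3]

end Cl31Aux

/-- There is an injective ℝ-algebra homomorphism `Φ_C : Cl(3,1) → M₄(ℂ)` sending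
the generators to the matrices `B₁, B₂, B₃, B₄` (Dirac spinor representation). -/
theorem cl31_embeds_in_M4C :
    ∃ Φ : CliffordAlgebra (Qpq 3 1) →ₐ[ℝ] Matrix (Fin 4) (Fin 4) ℂ,
      Function.Injective Φ ∧
      Φ (CliffordAlgebra.ι (Qpq 3 1) (Pi.single 0 1)) =
        !![0, 0, 0, 1; 0, 0, 1, 0; 0, 1, 0, 0; 1, 0, 0, 0] ∧
      Φ (CliffordAlgebra.ι (Qpq 3 1) (Pi.single 1 1)) =
        !![0, 0, 0, -Complex.I; 0, 0, Complex.I, 0;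
           0, -Complex.I, 0, 0; Complex.I, 0, 0, 0] ∧
      Φ (CliffordAlgebra.ι (Qpq 3 1) (Pi.single 2 1)) =
        !![0, 0, 1, 0; 0, 0, 0, -1; 1, 0, 0, 0; 0, -1, 0, 0] ∧
      Φ (CliffordAlgebra.ι (Qpq 3 1) (Pi.single 3 1)) =
        !![0, 0, 1, 0; 0, 0, 0, 1; -1, 0, 0, 0; 0, -1, 0, 0] := by
  exact ⟨Cl31Aux.Φ, Cl31Aux.Φ_inj, Cl31Aux.Φ0, Cl31Aux.Φ1, Cl31Aux.Φ2, Cl31Aux.Φ3⟩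
end

section
/- Let p, q be natural numbers with n = p + q even. If p − q ≡ 4 (mod 8) or p − q ≡ 6 (mod 8), then the Clifford algebra Cl(p,q) is isomorphic as an ℝ-algebra to the matrix algebra M_{2^{(n−2)/2}}(ℍ) of quaternionic square matrices of size 2^{(n−2)/2}. -/
open Quaternion Matrix CliffordAlgebra

open scoped TensorProduct

section core
variable {M N : Type} [AddCommGroup M] [Module ℝ M] [AddCommGroup N] [Module ℝ N]
  (Q : QuadraticForm ℝ M) (P : QuadraticForm ℝ N)

/-- `Cl(Q ⊕ P) ≅ Cl(cQ) ⊗ Cl(P)` for `P` binary, given by a volume element `e₁ e₂`. -/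
theorem cl_prod_aux (c : ℝ) (hc : c * c = 1) (e₁ e₂ : N)
    (h1 : ∀ w, ι P w * (ι P e₁ * ι P e₂) = - ((ι P e₁ * ι P e₂) * ι P w))
    (h2 : (ι P e₁ * ι P e₂) * (ι P e₁ * ι P e₂) = algebraMap ℝ _ c) :
    Nonempty (CliffordAlgebra (Q.prod P) ≃ₐ[ℝ]
      CliffordAlgebra (c • Q) ⊗[ℝ] CliffordAlgebra P) := by
  obtain ⟨ω, hω⟩ : ∃ ω, ω = ι P e₁ * ι P e₂ := ⟨_, rfl⟩
  have hω' := hω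
  rw [← hω] at h2
  simp only [← hω] at h1
  -- the forward map
  let f₀ : M × N →ₗ[ℝ] CliffordAlgebra (c • Q) ⊗[ℝ] CliffordAlgebra P :=
    LinearMap.coprod (((TensorProduct.mk ℝ _ _).flip ω).comp (ι (c • Q)))
      ((TensorProduct.mk ℝ _ _ 1).comp (ι P))
  have hf₀ : ∀ v w, f₀ (v, w) = ι (c • Q) v ⊗ₜ ω + 1 ⊗ₜ ι P w := fun v w => rfl
  have hf₁ : ∀ x, f₀ x * f₀ x = algebraMap ℝ _ (Q.prod P x) := by
    rintro ⟨v, w⟩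
    rw [hf₀, mul_add, add_mul, add_mul]
    simp only [Algebra.TensorProduct.tmul_mul_tmul, h1, h2, ι_sq_scalar, mul_one, one_mul,
      TensorProduct.tmul_neg, QuadraticMap.prod_apply, map_add]
    simp only [Algebra.algebraMap_eq_smul_one, TensorProduct.tmul_smul,
      _root_.smul_apply, smul_eq_mul, ← TensorProduct.smul_tmul', smul_smul,
      Algebra.TensorProduct.one_def]
    rw [← mul_assoc, hc, one_mul]
    abel
  let f : CliffordAlgebra (Q.prod P) →ₐ[ℝ] CliffordAlgebra (c • Q) ⊗[ℝ] CliffordAlgebra P :=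
    CliffordAlgebra.lift _ ⟨f₀, hf₁⟩
  have hf : ∀ v w, f (ι _ (v, w)) = ι (c • Q) v ⊗ₜ ω + 1 ⊗ₜ ι P w := fun v w => by
    simp only [f, lift_ι_apply, hf₀]
  -- the backward map
  let r : CliffordAlgebra P →ₐ[ℝ] CliffordAlgebra (Q.prod P) :=
    CliffordAlgebra.map (QuadraticMap.Isometry.inr Q P)
  have hr : ∀ w, r (ι P w) = ι (Q.prod P) (0, w) := fun w => by
    simp [r, CliffordAlgebra.map_apply_ι]
  have anti : ∀ v w, ι (Q.prod P) (0, w) * ι (Q.prod P) (v, 0)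
      = - (ι (Q.prod P) (v, 0) * ι (Q.prod P) (0, w)) := fun v w => by
    apply ι_mul_ι_comm_of_isOrtho
    simp [QuadraticMap.isOrtho_def, QuadraticMap.prod_apply, add_comm]
  have hcomm : ∀ v, r ω * ι (Q.prod P) (v, 0) = ι (Q.prod P) (v, 0) * r ω := fun v => by
    rw [hω, map_mul, hr, hr, mul_assoc, anti, mul_neg, ← mul_assoc, anti, neg_mul, neg_neg,
      mul_assoc]
  have hrr : r ω * r ω = algebraMap ℝ _ c := by
    rw [← map_mul, h2, AlgHom.commutes]
  let l₀ : M →ₗ[ℝ] CliffordAlgebra (Q.prod P) :=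
    c • (LinearMap.mulRight ℝ (r ω)).comp ((ι (Q.prod P)).comp (LinearMap.inl ℝ M N))
  have hl₀ : ∀ v, l₀ v = c • (ι (Q.prod P) (v, 0) * r ω) := fun v => rfl
  have hl₁ : ∀ v, l₀ v * l₀ v = algebraMap ℝ _ ((c • Q) v) := fun v => by
    rw [hl₀, smul_mul_smul_comm, hc, one_smul, mul_assoc, ← mul_assoc (r ω), hcomm, mul_assoc, hrr,
      ← mul_assoc, ι_sq_scalar, ← map_mul]
    simp [QuadraticMap.prod_apply, mul_comm]
  let l : CliffordAlgebra (c • Q) →ₐ[ℝ] CliffordAlgebra (Q.prod P) :=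
    CliffordAlgebra.lift _ ⟨l₀, hl₁⟩
  have hl : ∀ v, l (ι _ v) = c • (ι (Q.prod P) (v, 0) * r ω) := fun v => by
    simp only [l, lift_ι_apply, hl₀]
  have hlr0 : ∀ v w, Commute (l (ι _ v)) (r (ι _ w)) := fun v w => by
    rw [hl]
    apply Commute.smul_left
    have : r (ι P w) * r ω = - (r ω * r (ι P w)) := by rw [← map_mul, h1, map_neg, map_mul]
    show _ = _
    rw [mul_assoc, ← mul_assoc (r (ι P w)), hr, anti, neg_mul, mul_assoc, ← hr, this, mul_neg,
      neg_neg]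
  have hlr1 : ∀ v y, Commute (l (ι _ v)) (r y) := fun v y => by
    induction y using CliffordAlgebra.induction with
    | algebraMap t => rw [AlgHom.commutes]; exact (Algebra.commutes t _).symm
    | ι w => exact hlr0 v w
    | mul a b ha hb => rw [map_mul]; exact ha.mul_right hb
    | add a b ha hb => rw [map_add]; exact ha.add_right hb
  have hlr : ∀ x y, Commute (l x) (r y) := fun x y => by
    induction x using CliffordAlgebra.induction with
    | algebraMap t => rw [AlgHom.commutes]; exact (Algebra.commutes t _)
    | ι w => exact hlr1 w y
    | mul a b ha hb => rw [map_mul]; exact ha.mul_left hb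
    | add a b ha hb => rw [map_add]; exact ha.add_left hb
  let g : CliffordAlgebra (c • Q) ⊗[ℝ] CliffordAlgebra P →ₐ[ℝ] CliffordAlgebra (Q.prod P) :=
    Algebra.TensorProduct.lift l r hlr
  have hg : ∀ x y, g (x ⊗ₜ y) = l x * r y := fun x y => by simp [g]
  have hfr : ∀ y, f (r y) = 1 ⊗ₜ y := by
    have : f.comp r = Algebra.TensorProduct.includeRight := by
      apply CliffordAlgebra.hom_ext
      ext w
      simp [hr, hf]
    exact fun y => DFunLike.congr_fun this y
  have hfl : ∀ x, f (l x) = x ⊗ₜ 1 := by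
    have : f.comp l = Algebra.TensorProduct.includeLeft := by
      apply CliffordAlgebra.hom_ext
      ext v
      simp only [LinearMap.comp_apply, AlgHom.toLinearMap_apply, AlgHom.comp_apply, hl, map_smul,
        map_mul, hfr, hf, map_zero, TensorProduct.tmul_zero, add_zero,
        Algebra.TensorProduct.tmul_mul_tmul, mul_one, h2, Algebra.TensorProduct.includeLeft_apply]
      rw [Algebra.algebraMap_eq_smul_one, TensorProduct.tmul_smul, smul_smul, hc, one_smul]
    exact fun y => DFunLike.congr_fun this y
  refine ⟨AlgEquiv.ofAlgHom f g ?_ ?_⟩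
  · apply Algebra.TensorProduct.ext'
    intro x y
    simp [hg, hfl, hfr]
  · apply CliffordAlgebra.hom_ext
    apply LinearMap.ext
    rintro ⟨v, w⟩
    simp only [LinearMap.comp_apply, AlgHom.toLinearMap_apply, AlgHom.comp_apply, hf, map_add, hg,
      hl, map_one, one_mul, hr, AlgHom.id_apply]
    rw [smul_mul_assoc, mul_assoc, hrr, ← Algebra.commutes, ← Algebra.smul_def, smul_smul, hc,
      one_smul, ← map_add]
    simp

/-- The binary case for the quaternion-type forms. -/
theorem cl_prod_quat (a b c : ℝ) (hab : c = -(a * b)) (hc : c * c = 1) :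
    Nonempty (CliffordAlgebra (Q.prod (CliffordAlgebraQuaternion.Q a b)) ≃ₐ[ℝ]
      CliffordAlgebra (c • Q) ⊗[ℝ] ℍ[ℝ,a,0,b]) := by
  set P := CliffordAlgebraQuaternion.Q a b
  have s1 : ι P (1, 0) * ι P (1, 0) = algebraMap ℝ _ a := by
    rw [ι_sq_scalar]; simp [P]
  have s2 : ι P (0, 1) * ι P (0, 1) = algebraMap ℝ _ b := by
    rw [ι_sq_scalar]; simp [P]
  have s3 : ι P (0, 1) * ι P (1, 0) = - (ι P (1, 0) * ι P (0, 1)) := by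
    apply ι_mul_ι_comm_of_isOrtho
    simp [QuadraticMap.isOrtho_def, P, add_comm]
  obtain ⟨e⟩ := cl_prod_aux Q P c hc (1, 0) (0, 1) (by
    rintro ⟨x, y⟩
    have : ι P (x, y) = x • ι P (1, 0) + y • ι P (0, 1) := by
      rw [← map_smul, ← map_smul, ← map_add]; simp
    rw [this]
    simp only [add_mul, mul_add, smul_mul_assoc, mul_smul_comm, neg_add, ← smul_neg]
    congr 2
    · rw [mul_assoc _ (ι P (0, 1)), s3, mul_neg, neg_neg]
    · rw [← mul_assoc, s3, neg_mul]) (by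
    rw [mul_assoc, ← mul_assoc (ι P (0, 1)), s3, neg_mul, mul_assoc, s2, mul_neg, ← mul_assoc, s1,
      ← map_mul, ← map_neg, hab])
  exact ⟨e.trans (Algebra.TensorProduct.congr AlgEquiv.refl CliffordAlgebraQuaternion.equiv)⟩

end core

/-- The left regular matrix of a split quaternion. -/
def quatMat (b : ℝ) (x : ℍ[ℝ,1,0,b]) : Matrix (Fin 2) (Fin 2) ℝ :=
  !![x.re + x.imI, x.imJ + x.imK; b * (x.imJ - x.imK), x.re - x.imI]

theorem mat_two_congr {a b c d a' b' c' d' : ℝ} (h1 : a = a') (h2 : b = b') (h3 : c = c')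
    (h4 : d = d') : !![a, b; c, d] = !![a', b'; c', d'] := by
  rw [h1, h2, h3, h4]

theorem quatMat_mul (b : ℝ) (x y : ℍ[ℝ,1,0,b]) :
    quatMat b (x * y) = quatMat b x * quatMat b y := by
  unfold quatMat
  rw [Matrix.mul_fin_two]
  simp only [QuaternionAlgebra.re_mul, QuaternionAlgebra.imI_mul, QuaternionAlgebra.imJ_mul,
    QuaternionAlgebra.imK_mul]
  apply mat_two_congr <;> ring

/-- `ℍ[ℝ,1,0,b] ≅ M₂(ℝ)`. -/
theorem quat_split (b : ℝ) (hb : b * b = 1) :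
    Nonempty (ℍ[ℝ,1,0,b] ≃ₐ[ℝ] Matrix (Fin 2) (Fin 2) ℝ) := by
  let L : ℍ[ℝ,1,0,b] ≃ₗ[ℝ] Matrix (Fin 2) (Fin 2) ℝ := LinearEquiv.mk
    { toFun := quatMat b
      map_add' := by
        intro x y
        ext i j
        fin_cases i <;> fin_cases j <;> simp [quatMat] <;> ring
      map_smul' := by
        intro t x
        ext i j
        fin_cases i <;> fin_cases j <;> simp [quatMat] <;> ring }
    (fun m => ⟨(m 0 0 + m 1 1) / 2, (m 0 0 - m 1 1) / 2, (m 0 1 + b * m 1 0) / 2,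
      (m 0 1 - b * m 1 0) / 2⟩)
    (by
      intro x
      ext <;> simp [quatMat]
      · linear_combination (x.imJ - x.imK) / 2 * hb
      · linear_combination (x.imK - x.imJ) / 2 * hb)
    (by
      intro m
      ext i j
      fin_cases i <;> fin_cases j <;> simp [quatMat] <;> try ring
      linear_combination m 1 0 * hb)
  have hL : ∀ x, L x = quatMat b x := fun x => rfl
  refine ⟨AlgEquiv.ofLinearEquiv L ?_ ?_⟩
  · rw [hL]
    ext i j
    fin_cases i <;> fin_cases j <;> simp [quatMat]
  · intro x y
    rw [hL, hL, hL, quatMat_mul]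

theorem tensor_right_comm (A B C : Type) [Ring A] [Algebra ℝ A] [Ring B] [Algebra ℝ B] [Ring C]
    [Algebra ℝ C] : Nonempty ((A ⊗[ℝ] B) ⊗[ℝ] C ≃ₐ[ℝ] (A ⊗[ℝ] C) ⊗[ℝ] B) :=
  ⟨((Algebra.TensorProduct.assoc ℝ ℝ ℝ A B C).trans
    (Algebra.TensorProduct.congr AlgEquiv.refl (Algebra.TensorProduct.comm ℝ B C))).trans
    (Algebra.TensorProduct.assoc ℝ ℝ ℝ A C B).symm⟩

/-- Signature `(p,q)` form on a sum type. -/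
noncomputable def Wpq (p q : ℕ) : QuadraticForm ℝ (Fin p ⊕ Fin q → ℝ) :=
  QuadraticMap.weightedSumSquares ℝ (Sum.elim (fun _ => (1 : ℝ)) (fun _ => -1))

theorem Wpq_apply (p q : ℕ) (x : Fin p ⊕ Fin q → ℝ) :
    Wpq p q x = ∑ i, x (Sum.inl i) * x (Sum.inl i) - ∑ i, x (Sum.inr i) * x (Sum.inr i) := by
  simp [Wpq, QuadraticMap.weightedSumSquares_apply, sub_eq_add_neg]

theorem cl_iso_of {M N : Type} [AddCommGroup M] [Module ℝ M] [AddCommGroup N] [Module ℝ N]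
    {Q : QuadraticForm ℝ M} {P : QuadraticForm ℝ N} (e : M ≃ₗ[ℝ] N) (h : ∀ x, P (e x) = Q x) :
    Nonempty (CliffordAlgebra Q ≃ₐ[ℝ] CliffordAlgebra P) :=
  ⟨CliffordAlgebra.equivOfIsometry ⟨e, h⟩⟩

theorem cl_Qpq (p q : ℕ) :
    Nonempty (CliffordAlgebra (Qpq p q) ≃ₐ[ℝ] CliffordAlgebra (Wpq p q)) := by
  apply cl_iso_of (LinearEquiv.funCongrLeft ℝ ℝ finSumFinEquiv)
  intro x
  simp [Wpq_apply, Qpq, QuadraticMap.weightedSumSquares_apply, Fin.sum_univ_add,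
    LinearEquiv.funCongrLeft_apply, LinearMap.funLeft_apply, sub_eq_add_neg]

/-- The coordinates of a split vector. -/
noncomputable def splitEquiv (p q a b : ℕ) : (Fin (p + a) ⊕ Fin (q + b) → ℝ) ≃ₗ[ℝ]
    (Fin p ⊕ Fin q → ℝ) × (Fin a ⊕ Fin b → ℝ) :=
  (LinearEquiv.funCongrLeft ℝ ℝ ((Equiv.sumSumSumComm (Fin p) (Fin q) (Fin a) (Fin b)).trans
    (Equiv.sumCongr finSumFinEquiv finSumFinEquiv))).trans
    (LinearEquiv.sumArrowLequivProdArrow _ _ ℝ ℝ)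

theorem split_form (p q a b : ℕ) (x) :
    (Wpq p q).prod (Wpq a b) (splitEquiv p q a b x) = Wpq (p + a) (q + b) x := by
  simp [Wpq_apply, QuadraticMap.prod_apply, splitEquiv, Fin.sum_univ_add,
    LinearEquiv.funCongrLeft_apply, LinearMap.funLeft_apply, Equiv.sumSumSumComm]
  ring

theorem cl_split (p q a b : ℕ) {N : Type} [AddCommGroup N] [Module ℝ N] (P : QuadraticForm ℝ N)
    (e : (Fin a ⊕ Fin b → ℝ) ≃ₗ[ℝ] N) (h : ∀ x, P (e x) = Wpq a b x) :
    Nonempty (CliffordAlgebra (Wpq (p + a) (q + b)) ≃ₐ[ℝ]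
      CliffordAlgebra ((Wpq p q).prod P)) := by
  apply cl_iso_of ((splitEquiv p q a b).trans ((LinearEquiv.refl ℝ _).prodCongr e))
  intro x
  rw [← split_form]
  simp [QuadraticMap.prod_apply, h]

theorem cl_neg (p q : ℕ) : Nonempty (CliffordAlgebra ((-1 : ℝ) • Wpq p q) ≃ₐ[ℝ]
    CliffordAlgebra (Wpq q p)) := by
  apply cl_iso_of (LinearEquiv.funCongrLeft ℝ ℝ (Equiv.sumComm _ _))
  intro x
  simp [Wpq_apply, LinearEquiv.funCongrLeft_apply, LinearMap.funLeft_apply]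

/-- Coordinates from an enumeration of the index type. -/
noncomputable def twoEquiv {ι : Type} (e : Fin 2 ≃ ι) : (ι → ℝ) ≃ₗ[ℝ] ℝ × ℝ :=
  (LinearEquiv.funCongrLeft ℝ ℝ e).trans (LinearEquiv.finTwoArrow ℝ ℝ)

theorem twoEquiv_apply {ι : Type} (e : Fin 2 ≃ ι) (x : ι → ℝ) :
    twoEquiv e x = (x (e 0), x (e 1)) := rfl

theorem form11 (x) : CliffordAlgebraQuaternion.Q (1 : ℝ) (-1)
    (twoEquiv (finSumFinEquiv (m := 1) (n := 1)).symm x) = Wpq 1 1 x := by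
  have h0 : (finSumFinEquiv (m := 1) (n := 1)).symm 0 = Sum.inl 0 := rfl
  have h1 : (finSumFinEquiv (m := 1) (n := 1)).symm 1 = Sum.inr 0 := rfl
  simp [twoEquiv_apply, Wpq_apply, h0, h1, sub_eq_add_neg]

theorem form20 (x) : CliffordAlgebraQuaternion.Q (1 : ℝ) 1
    (twoEquiv (finSumFinEquiv (m := 2) (n := 0)).symm x) = Wpq 2 0 x := by
  have h0 : (finSumFinEquiv (m := 2) (n := 0)).symm 0 = Sum.inl 0 := rfl
  have h1 : (finSumFinEquiv (m := 2) (n := 0)).symm 1 = Sum.inl 1 := rfl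
  simp [twoEquiv_apply, Wpq_apply, h0, h1, Fin.sum_univ_two]

theorem form02 (x) : CliffordAlgebraQuaternion.Q (-1 : ℝ) (-1)
    (twoEquiv (finSumFinEquiv (m := 0) (n := 2)).symm x) = Wpq 0 2 x := by
  have h0 : (finSumFinEquiv (m := 0) (n := 2)).symm 0 = Sum.inr 0 := rfl
  have h1 : (finSumFinEquiv (m := 0) (n := 2)).symm 1 = Sum.inr 1 := rfl
  simp [twoEquiv_apply, Wpq_apply, h0, h1, Fin.sum_univ_two]
  ring

theorem cl_02 : Nonempty (CliffordAlgebra (Wpq 0 2) ≃ₐ[ℝ] ℍ[ℝ]) := by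
  obtain ⟨e⟩ := cl_iso_of _ form02
  exact ⟨e.trans CliffordAlgebraQuaternion.equiv⟩

theorem cl_step11 (p q : ℕ) : Nonempty (CliffordAlgebra (Wpq (p + 1) (q + 1)) ≃ₐ[ℝ]
    CliffordAlgebra (Wpq p q) ⊗[ℝ] Matrix (Fin 2) (Fin 2) ℝ) := by
  obtain ⟨e⟩ := cl_split p q 1 1 _ _ form11
  obtain ⟨e'⟩ := cl_prod_quat (Wpq p q) 1 (-1) 1 (by norm_num) (by norm_num)
  obtain ⟨s⟩ := quat_split (-1) (by norm_num)
  obtain ⟨n⟩ : Nonempty (CliffordAlgebra ((1 : ℝ) • Wpq p q) ≃ₐ[ℝ]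
    CliffordAlgebra (Wpq p q)) := cl_iso_of (LinearEquiv.refl ℝ _) (by simp)
  exact ⟨(e.trans e').trans (Algebra.TensorProduct.congr n s)⟩

theorem cl_step20 (p q : ℕ) : Nonempty (CliffordAlgebra (Wpq (p + 2) q) ≃ₐ[ℝ]
    CliffordAlgebra (Wpq q p) ⊗[ℝ] Matrix (Fin 2) (Fin 2) ℝ) := by
  obtain ⟨e⟩ := cl_split p q 2 0 _ _ form20
  obtain ⟨e'⟩ := cl_prod_quat (Wpq p q) 1 1 (-1) (by norm_num) (by norm_num)
  obtain ⟨s⟩ := quat_split 1 (by norm_num)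
  obtain ⟨n⟩ := cl_neg p q
  exact ⟨(e.trans e').trans (Algebra.TensorProduct.congr n s)⟩

theorem cl_step02 (p q : ℕ) : Nonempty (CliffordAlgebra (Wpq p (q + 2)) ≃ₐ[ℝ]
    CliffordAlgebra (Wpq q p) ⊗[ℝ] ℍ[ℝ]) := by
  obtain ⟨e⟩ := cl_split p q 0 2 _ _ form02
  obtain ⟨e'⟩ := cl_prod_quat (Wpq p q) (-1) (-1) (-1) (by norm_num) (by norm_num)
  obtain ⟨n⟩ := cl_neg p q
  exact ⟨(e.trans e').trans (Algebra.TensorProduct.congr n AlgEquiv.refl)⟩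

theorem cl_swap4 (q : ℕ) : Nonempty (CliffordAlgebra (Wpq 0 (q + 4)) ≃ₐ[ℝ]
    CliffordAlgebra (Wpq 4 q)) := by
  obtain ⟨a⟩ := cl_step02 0 (q + 2)
  obtain ⟨b⟩ := cl_step20 q 0
  obtain ⟨c⟩ := cl_step20 2 q
  obtain ⟨d⟩ := cl_step02 q 0
  obtain ⟨t⟩ := tensor_right_comm (CliffordAlgebra (Wpq 0 q)) (Matrix (Fin 2) (Fin 2) ℝ) ℍ[ℝ]
  exact ⟨((a.trans (Algebra.TensorProduct.congr b AlgEquiv.refl)).trans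
    t).trans
    (c.trans (Algebra.TensorProduct.congr d AlgEquiv.refl)).symm⟩

theorem mat_step {A : Type} [Ring A] [Algebra ℝ A] (m : ℕ)
    (h : Nonempty (A ≃ₐ[ℝ] Matrix (Fin (2 ^ m)) (Fin (2 ^ m)) ℍ[ℝ])) :
    Nonempty (A ⊗[ℝ] Matrix (Fin 2) (Fin 2) ℝ ≃ₐ[ℝ]
      Matrix (Fin (2 ^ (m + 1))) (Fin (2 ^ (m + 1))) ℍ[ℝ]) := by
  obtain ⟨e⟩ := h
  exact ⟨(((matrixEquivTensor (Fin 2) ℝ A).symm.trans e.mapMatrix).trans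
    (Matrix.compAlgEquiv (Fin 2) (Fin (2 ^ m)) ℍ[ℝ] ℝ)).trans
    (Matrix.reindexAlgEquiv ℝ ℍ[ℝ] (finProdFinEquiv.trans (finCongr (by ring))))⟩

theorem mat_zero {A : Type} [Ring A] [Algebra ℝ A] (h : Nonempty (A ≃ₐ[ℝ] ℍ[ℝ])) :
    Nonempty (A ≃ₐ[ℝ] Matrix (Fin (2 ^ 0)) (Fin (2 ^ 0)) ℍ[ℝ]) := by
  obtain ⟨e⟩ := h
  exact ⟨e.trans ((Matrix.uniqueAlgEquiv (m := Unit) (R := ℝ) (A := ℍ[ℝ])).symm.trans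
    (Matrix.reindexAlgEquiv ℝ ℍ[ℝ] (finOneEquiv.symm.trans (finCongr (by simp)))))⟩

theorem cl_main (k : ℕ) : ∀ (p q m : ℕ), 2 * (p + q) + (if p = 0 then 1 else 0) = k →
    p + q = 2 * m + 2 → (((p : ℤ) - q) % 8 = 4 ∨ ((p : ℤ) - q) % 8 = 6) →
    Nonempty (CliffordAlgebra (Wpq p q) ≃ₐ[ℝ] Matrix (Fin (2 ^ m)) (Fin (2 ^ m)) ℍ[ℝ]) := by
  induction k using Nat.strong_induction_on with
  | _ k ih =>
  intro p q m hk hm h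
  rcases p with _ | p
  · obtain rfl | ⟨q, rfl⟩ : q = 2 ∨ ∃ r, q = r + 4 := by
      by_cases h2 : q = 2
      · exact Or.inl h2
      · exact Or.inr ⟨q - 4, by omega⟩
    · obtain rfl : m = 0 := by omega
      exact mat_zero cl_02
    · obtain ⟨e⟩ := cl_swap4 q
      obtain ⟨e'⟩ := ih (2 * (4 + q)) (by simp at hk; omega) 4 q m (by simp) (by omega)
        (by push_cast at h ⊢; omega)
      exact ⟨e.trans e'⟩
  · obtain ⟨m, rfl⟩ : ∃ t, m = t + 1 := ⟨m - 1, by omega⟩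
    rcases q with _ | q
    · obtain ⟨p, rfl⟩ : ∃ t, p = t + 1 := ⟨p - 1, by omega⟩
      obtain ⟨e⟩ := cl_step20 p 0
      obtain ⟨e'⟩ := mat_step m (ih _ (by simp at hk ⊢; omega) 0 p m rfl (by omega)
        (by push_cast at h ⊢; omega))
      exact ⟨e.trans e'⟩
    · obtain ⟨e⟩ := cl_step11 p q
      obtain ⟨e'⟩ := mat_step m (ih _ (by simp at hk ⊢; split_ifs <;> omega) p q m rfl (by omega)
        (by push_cast at h ⊢; omega))
      exact ⟨e.trans e'⟩

/-- For `n = p + q` even with `p − q ≡ 4, 6 (mod 8)`, `Cl(p,q) ≅ M_{2^{(n−2)/2}}(ℍ)`. -/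
theorem clpq_even_46_iso_matrix_quaternion (p q : ℕ) (hn : Even (p + q))
    (h : (p : ℤ) - q ≡ 4 [ZMOD 8] ∨ (p : ℤ) - q ≡ 6 [ZMOD 8]) :
    Nonempty (CliffordAlgebra (Qpq p q) ≃ₐ[ℝ]
      (Matrix (Fin (2 ^ ((p + q - 2) / 2))) (Fin (2 ^ ((p + q - 2) / 2))) ℍ[ℝ])) := by
  obtain ⟨e⟩ := cl_Qpq p q
  obtain ⟨e'⟩ := cl_main _ p q ((p + q - 2) / 2) rfl
    (by obtain ⟨r, hr⟩ := hn; unfold Int.ModEq at h; omega) (by unfold Int.ModEq at h; omega)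
  exact ⟨e.trans e'⟩
end

section
/- Let p, q be natural numbers with n = p + q odd. If p − q ≡ 1 (mod 8), then the Clifford algebra Cl(p,q) is isomorphic as an ℝ-algebra to the product M_{2^{(n−1)/2}}(ℝ) × M_{2^{(n−1)/2}}(ℝ) of two copies of the real matrix algebra of size 2^{(n−1)/2} (equivalently, to the algebra of block-diagonal matrices diag(A, B) with A, B ∈ M_{2^{(n−1)/2}}(ℝ)). -/
open Quaternion Matrix CliffordAlgebra

namespace ClAux

/-- `A` is generated by anticommuting elements squaring to `±1` according to `w`. -/
def Rep {ι : Type} (w : ι → Bool) (A : Type) [Ring A] [Algebra ℝ A] : Prop :=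
  ∃ e : ι → A, (∀ i, e i * e i = if w i then 1 else -1) ∧
    (∀ i j, i ≠ j → e i * e j = -(e j * e i)) ∧ Algebra.adjoin ℝ (Set.range e) = ⊤

lemma Rep.map {ι : Type} {w : ι → Bool} {A B : Type} [Ring A] [Algebra ℝ A] [Ring B] [Algebra ℝ B]
    (h : Rep w A) (f : A →ₐ[ℝ] B) (hf : Function.Surjective f) : Rep w B := by
  obtain ⟨e, h1, h2, h3⟩ := h
  refine ⟨fun i => f (e i), fun i => ?_, fun i j hij => ?_, ?_⟩
  · rw [← map_mul, h1]; split_ifs <;> simp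
  · rw [← map_mul, h2 i j hij]; simp
  · have : Set.range (fun i => f (e i)) = f '' Set.range e := by
      rw [← Set.range_comp]; rfl
    rw [this, ← AlgHom.map_adjoin, h3, Algebra.map_top, AlgHom.range_eq_top]
    exact hf

lemma Rep.reindex {ι κ : Type} {w : ι → Bool} {w' : κ → Bool} {A : Type} [Ring A] [Algebra ℝ A]
    (h : Rep w A) (σ : κ ≃ ι) (hσ : ∀ k, w (σ k) = w' k) : Rep w' A := by
  obtain ⟨e, h1, h2, h3⟩ := h
  refine ⟨e ∘ σ, fun i => ?_, fun i j hij => ?_, ?_⟩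
  · simp [h1, hσ]
  · exact h2 _ _ (fun hh => hij (σ.injective hh))
  · rw [σ.surjective.range_comp, h3]

lemma exists_equiv {ι κ : Type} [Fintype ι] [Fintype κ] (w : ι → Bool) (w' : κ → Bool)
    (ht : (∑ i, if w i = true then 1 else 0) = ∑ i, if w' i = true then 1 else 0)
    (hf : (∑ i, if w i = false then 1 else 0) = ∑ i, if w' i = false then 1 else 0) :
    ∃ σ : κ ≃ ι, ∀ k, w (σ k) = w' k := by
  have key : ∀ b : Bool, Nonempty ({k // w' k = b} ≃ {i // w i = b}) := by
    intro b
    rw [← Fintype.card_eq, Fintype.card_subtype, Fintype.card_subtype, Finset.card_filter,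
      Finset.card_filter]
    cases b
    · exact hf.symm
    · exact ht.symm
  exact ⟨Equiv.ofFiberEquiv (fun b => (key b).some), fun k => Equiv.ofFiberEquiv_map _ k⟩

lemma Rep.reindex' {ι κ : Type} [Fintype ι] [Fintype κ] {w : ι → Bool} {w' : κ → Bool}
    {A : Type} [Ring A] [Algebra ℝ A] (h : Rep w A)
    (ht : (∑ i, if w i = true then 1 else 0) = ∑ i, if w' i = true then 1 else 0)
    (hf : (∑ i, if w i = false then 1 else 0) = ∑ i, if w' i = false then 1 else 0) :
    Rep w' A := by
  obtain ⟨σ, hσ⟩ := exists_equiv w w' ht hf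
  exact h.reindex σ hσ

lemma Rep.mat {ι : Type} {w : ι → Bool} {A : Type} [Ring A] [Algebra ℝ A] (h : Rep w A) :
    Rep (Sum.elim w (id : Bool → Bool)) (Matrix (Fin 2) (Fin 2) A) := by
  obtain ⟨e, h1, h2, h3⟩ := h
  let g : ι ⊕ Bool → Matrix (Fin 2) (Fin 2) A :=
    Sum.elim (fun i => !![e i, 0; 0, -e i]) (fun b => if b then !![0, 1; 1, 0] else !![0, 1; -1, 0])
  refine ⟨g, ?_, ?_, ?_⟩
  · rintro (i | b)
    · have := h1 i
      by_cases hw : w i <;> simp [g, hw, Matrix.one_fin_two] at this ⊢ <;> simp [this]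
    · cases b <;> simp [g, Matrix.one_fin_two]
  · rintro (i | b) (j | c) hij
    · have := h2 i j (fun hh => hij (by rw [hh]))
      simp [g, this]
    · cases c <;> simp [g]
    · cases b <;> simp [g]
    · cases b <;> cases c <;> simp [g] at hij ⊢
  · set S := Algebra.adjoin ℝ (Set.range g) with hS
    have hg : ∀ x, g x ∈ S := fun x => Algebra.subset_adjoin ⟨x, rfl⟩
    have hX : !![0, 1; 1, 0] ∈ S := by simpa [g] using hg (Sum.inr true)
    have hY : !![0, 1; -1, 0] ∈ S := by simpa [g] using hg (Sum.inr false)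
    have hE : !![-1, 0; 0, 1] ∈ S := by simpa using S.mul_mem hX hY
    have hP : !![1, 0; 0, 0] ∈ S := by
      have := S.smul_mem (S.sub_mem S.one_mem hE) (1/2 : ℝ)
      convert this using 1
      ext i j
      fin_cases i <;> fin_cases j <;> simp [Matrix.one_fin_two]
      rw [← add_smul]
      norm_num
    have hQ : !![0, 0; 0, 1] ∈ S := by
      convert S.sub_mem S.one_mem hP using 1
      ext i j
      fin_cases i <;> fin_cases j <;> simp
    have hD : ∀ a : A, !![a, 0; 0, a] ∈ S := by
      intro a
      have ha : a ∈ Algebra.adjoin ℝ (Set.range e) := by rw [h3]; trivial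
      induction ha using Algebra.adjoin_induction with
      | mem x hx =>
        obtain ⟨i, rfl⟩ := hx
        simpa [g] using S.neg_mem (S.mul_mem (hg (Sum.inl i)) hE)
      | algebraMap r =>
        convert S.algebraMap_mem r using 1
        ext i j
        fin_cases i <;> fin_cases j <;> simp [Matrix.algebraMap_matrix_apply]
      | add x y _ _ hx hy => simpa using S.add_mem hx hy
      | mul x y _ _ hx hy => simpa using S.mul_mem hx hy
    rw [eq_top_iff]
    rintro M -
    have := S.add_mem (S.add_mem (S.mul_mem (hD (M 0 0)) hP)
      (S.mul_mem (S.mul_mem (hD (M 0 1)) hP) hX))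
      (S.add_mem (S.mul_mem (hD (M 1 1)) hQ) (S.mul_mem (S.mul_mem (hD (M 1 0)) hQ) hX))
    convert this using 1
    ext i j
    fin_cases i <;> fin_cases j <;> simp

lemma four {A : Type} [Ring A] {a b c d : A} {s : Bool}
    (ha : a * a = if s then 1 else -1) (hb : b * b = if s then 1 else -1)
    (hc : c * c = if s then 1 else -1) (hd : d * d = if s then 1 else -1)
    (hba : b * a = -(a * b)) (hca : c * a = -(a * c)) (hda : d * a = -(a * d))
    (hcb : c * b = -(b * c)) (hdb : d * b = -(b * d)) (hdc : d * c = -(c * d)) :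
    (a * b * c * d) * (a * b * c * d) = 1 ∧
    ((a * b * c * d) * a = -(a * (a * b * c * d)) ∧ (a * b * c * d) * b = -(b * (a * b * c * d)) ∧
    (a * b * c * d) * c = -(c * (a * b * c * d)) ∧ (a * b * c * d) * d = -(d * (a * b * c * d))) := by
  have lift : ∀ {u v w : A}, u * v = w → ∀ x, u * (v * x) = w * x := by
    intro u v w h x
    rw [← mul_assoc, h]
  have ha' := lift ha
  have hb' := lift hb
  have hc' := lift hc
  have hd' := lift hd
  have hba' := lift hba
  have hca' := lift hca
  have hda' := lift hda
  have hcb' := lift hcb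
  have hdb' := lift hdb
  have hdc' := lift hdc
  cases s <;>
  simp [mul_assoc, ha, hb, hc, hd, hba, hca, hda, hcb, hdb, hdc, ha', hb', hc', hd', hba', hca',
    hda', hcb', hdb', hdc']

lemma Rep.flip {κ : Type} {w : κ → Bool} (b : Bool) {A : Type} [Ring A] [Algebra ℝ A]
    (h : Rep (Sum.elim (fun _ : Fin 4 => b) w) A) :
    Rep (Sum.elim (fun _ : Fin 4 => !b) w) A := by
  obtain ⟨e, h1, h2, h3⟩ := h
  have h1' : ∀ i : Fin 4, e (.inl i) * e (.inl i) = if b then 1 else -1 := fun i => h1 (.inl i)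
  have h2' : ∀ i j : Fin 4, i ≠ j → e (.inl i) * e (.inl j) = -(e (.inl j) * e (.inl i)) :=
    fun i j hij => h2 _ _ (by simpa using hij)
  obtain ⟨hω2, hωa⟩ := four (h1' 0) (h1' 1) (h1' 2) (h1' 3) (h2' 1 0 (by decide))
    (h2' 2 0 (by decide)) (h2' 3 0 (by decide)) (h2' 2 1 (by decide)) (h2' 3 1 (by decide))
    (h2' 3 2 (by decide))
  have hωk : ∀ k, e (.inr k) * (e (.inl 0) * e (.inl 1) * e (.inl 2) * e (.inl 3)) =
      (e (.inl 0) * e (.inl 1) * e (.inl 2) * e (.inl 3)) * e (.inr k) := by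
    intro k
    have hk : ∀ i : Fin 4, e (.inr k) * e (.inl i) = -(e (.inl i) * e (.inr k)) :=
      fun i => h2 _ _ (by simp)
    have hk' : ∀ (i : Fin 4) x, e (.inr k) * (e (.inl i) * x) = -(e (.inl i) * (e (.inr k) * x)) := by
      intro i x
      rw [← mul_assoc, hk, neg_mul, mul_assoc]
    simp only [mul_assoc, hk, hk', mul_neg, neg_neg]
  have hωi : ∀ i : Fin 4, (e (.inl 0) * e (.inl 1) * e (.inl 2) * e (.inl 3)) * e (.inl i) =
      -(e (.inl i) * (e (.inl 0) * e (.inl 1) * e (.inl 2) * e (.inl 3))) := by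
    intro i
    fin_cases i
    exacts [hωa.1, hωa.2.1, hωa.2.2.1, hωa.2.2.2]
  have hω4 : e (.inl 0) * e (.inl 1) * (e (.inl 2) * e (.inl 3)) =
      e (.inl 0) * e (.inl 1) * e (.inl 2) * e (.inl 3) := by simp only [mul_assoc]
  generalize e (.inl 0) * e (.inl 1) * e (.inl 2) * e (.inl 3) = ω at *
  have hpair : ∀ i j : Fin 4, (e (.inl i) * ω) * (e (.inl j) * ω) = -(e (.inl i) * e (.inl j)) := by
    intro i j
    rw [mul_assoc, ← mul_assoc ω, hωi, neg_mul, mul_assoc, hω2, mul_one, mul_neg]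
  let g : Fin 4 ⊕ κ → A := Sum.elim (fun i => e (.inl i) * ω) (fun k => e (.inr k))
  refine ⟨g, ?_, ?_, ?_⟩
  · rintro (i | k)
    · simp only [g, Sum.elim_inl, hpair, h1']
      cases b <;> simp
    · exact h1 (.inr k)
  · rintro (i | k) (j | l) hij
    · simp only [g, Sum.elim_inl, hpair]
      rw [h2' i j (by simpa using hij)]
    · simp only [g, Sum.elim_inl, Sum.elim_inr]
      rw [mul_assoc, ← hωk, ← mul_assoc, ← mul_assoc, h2 (.inl i) (.inr l) (by simp), neg_mul]
    · simp only [g, Sum.elim_inl, Sum.elim_inr]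
      rw [mul_assoc, ← hωk, ← mul_assoc, ← mul_assoc, h2 (.inr k) (.inl j) (by simp), neg_mul]
    · exact h2 _ _ hij
  · set S := Algebra.adjoin ℝ (Set.range g) with hS
    have hg : ∀ x, g x ∈ S := fun x => Algebra.subset_adjoin ⟨x, rfl⟩
    have hω : ω ∈ S := by
      have := S.mul_mem (S.mul_mem (hg (.inl 0)) (hg (.inl 1)))
        (S.mul_mem (hg (.inl 2)) (hg (.inl 3)))
      simpa only [g, Sum.elim_inl, hpair, neg_mul_neg, hω4] using this
    rw [eq_top_iff, ← h3, Algebra.adjoin_le_iff]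
    rintro _ ⟨i | k, rfl⟩
    · have := S.mul_mem (hg (.inl i)) hω
      simpa only [g, Sum.elim_inl, mul_assoc, hω2, mul_one, SetLike.mem_coe] using this
    · exact hg (.inr k)

/-- the signature `(p,q)` weight -/
def wt (p q : ℕ) : Fin p ⊕ Fin q → Bool := Sum.elim (fun _ => true) (fun _ => false)

abbrev MM (k : ℕ) : Type :=
  Matrix (Fin (2 ^ k)) (Fin (2 ^ k)) ℝ × Matrix (Fin (2 ^ k)) (Fin (2 ^ k)) ℝ

lemma up {p q : ℕ} {A : Type} [Ring A] [Algebra ℝ A] (h : Rep (wt p (q + 4)) A) :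
    Rep (wt (p + 4) q) A := by
  have h' : Rep (Sum.elim (fun _ : Fin 4 => false) (wt p q)) A :=
    h.reindex' (by simp [wt, Fintype.sum_sum_type, -Finset.sum_boole] <;> omega) (by simp [wt, Fintype.sum_sum_type, -Finset.sum_boole] <;> omega)
  exact h'.flip.reindex' (by simp [wt, Fintype.sum_sum_type, -Finset.sum_boole] <;> omega) (by simp [wt, Fintype.sum_sum_type, -Finset.sum_boole] <;> omega)

lemma down {p q : ℕ} {A : Type} [Ring A] [Algebra ℝ A] (h : Rep (wt (p + 4) q) A) :
    Rep (wt p (q + 4)) A := by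
  have h' : Rep (Sum.elim (fun _ : Fin 4 => true) (wt p q)) A :=
    h.reindex' (by simp [wt, Fintype.sum_sum_type, -Finset.sum_boole] <;> omega) (by simp [wt, Fintype.sum_sum_type, -Finset.sum_boole] <;> omega)
  exact h'.flip.reindex' (by simp [wt, Fintype.sum_sum_type, -Finset.sum_boole] <;> omega) (by simp [wt, Fintype.sum_sum_type, -Finset.sum_boole] <;> omega)

lemma ups (k : ℕ) : ∀ {p q : ℕ} {A : Type} [Ring A] [Algebra ℝ A], Rep (wt p (q + 4 * k)) A →
    Rep (wt (p + 4 * k) q) A := by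
  induction k with
  | zero => intro p q A _ _ h; exact h
  | succ k ih =>
    intro p q A _ _ h
    have := ih (p := p + 4) (q := q) (up h)
    rwa [add_assoc, show 4 + 4 * k = 4 * (k + 1) by ring] at this

lemma downs (k : ℕ) : ∀ {p q : ℕ} {A : Type} [Ring A] [Algebra ℝ A], Rep (wt (p + 4 * k) q) A →
    Rep (wt p (q + 4 * k)) A := by
  induction k with
  | zero => intro p q A _ _ h; exact h
  | succ k ih =>
    intro p q A _ _ h
    have := ih (p := p) (q := q + 4) (down h)
    rwa [add_assoc, show 4 + 4 * k = 4 * (k + 1) by ring] at this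

lemma base : Rep (wt 1 0) (MM 0) := by
  have h : Rep (wt 1 0) (ℝ × ℝ) := by
    refine ⟨fun _ => (1, -1), ?_, ?_, ?_⟩
    · rintro (i | i)
      · simp [wt]
      · exact i.elim0
    · rintro (i | i) (j | j) hij
      · exact absurd (by rw [Subsingleton.elim i j]) hij
      · exact j.elim0
      · exact i.elim0
      · exact j.elim0
    · rw [eq_top_iff]
      rintro ⟨a, b⟩ -
      have h1 : ((1, -1) : ℝ × ℝ) ∈ Algebra.adjoin ℝ
          (Set.range (fun _ : Fin 1 ⊕ Fin 0 => ((1, -1) : ℝ × ℝ))) :=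
        Algebra.subset_adjoin ⟨.inl 0, rfl⟩
      have := Subalgebra.add_mem _ (Subalgebra.smul_mem _ h1 ((a - b) / 2))
        (Subalgebra.algebraMap_mem _ ((a + b) / 2))
      convert this using 1
      ext <;> simp <;> ring
  let f : ℝ →ₐ[ℝ] Matrix (Fin (2 ^ 0)) (Fin (2 ^ 0)) ℝ := Algebra.ofId _ _
  have hf : Function.Surjective f := by
    intro M
    refine ⟨M 0 0, ?_⟩
    ext i j
    obtain rfl : i = 0 := Fin.ext (by have := i.2; simp at this; simp [this])
    obtain rfl : j = 0 := Fin.ext (by have := j.2; simp at this; simp [this])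
    simp [f, Algebra.ofId_apply, Matrix.algebraMap_matrix_apply]
  refine h.map (AlgHom.prodMap f f) ?_
  exact hf.prodMap hf

lemma step {p q k : ℕ} (h : Rep (wt p q) (MM k)) : Rep (wt (p + 1) (q + 1)) (MM (k + 1)) := by
  have h1 : Rep (wt (p + 1) (q + 1)) (Matrix (Fin 2) (Fin 2) (MM k)) :=
    h.mat.reindex' (by simp [wt, Fintype.sum_sum_type, -Finset.sum_boole] <;> omega) (by simp [wt, Fintype.sum_sum_type, -Finset.sum_boole] <;> omega)
  let X := Matrix (Fin (2 ^ k)) (Fin (2 ^ k)) ℝ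
  let F : Matrix (Fin 2) (Fin 2) (MM k) →ₐ[ℝ] Matrix (Fin 2) (Fin 2) X × Matrix (Fin 2) (Fin 2) X :=
    AlgHom.prod (AlgHom.fst ℝ X X).mapMatrix (AlgHom.snd ℝ X X).mapMatrix
  have hF : Function.Surjective F := by
    rintro ⟨M, N⟩
    refine ⟨Matrix.of fun i j => (M i j, N i j), ?_⟩
    ext <;> rfl
  let G : Matrix (Fin 2) (Fin 2) X ≃ₐ[ℝ] Matrix (Fin (2 ^ (k + 1))) (Fin (2 ^ (k + 1))) ℝ :=
    (Matrix.compAlgEquiv (Fin 2) (Fin (2 ^ k)) ℝ ℝ).trans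
      (Matrix.reindexAlgEquiv ℝ ℝ (finProdFinEquiv.trans (finCongr (by ring))))
  exact (h1.map F hF).map (AlgEquiv.prodCongr G G).toAlgHom (AlgEquiv.prodCongr G G).surjective

lemma diag (k : ℕ) : Rep (wt (k + 1) k) (MM k) := by
  induction k with
  | zero => exact base
  | succ k ih => exact step ih

lemma finrank_cl {n : ℕ} (Q : QuadraticForm ℝ (Fin n → ℝ)) :
    Module.finrank ℝ (CliffordAlgebra Q) = 2 ^ n ∧ Module.Finite ℝ (CliffordAlgebra Q) := by
  have : Invertible (2 : ℝ) := invertibleOfNonzero two_ne_zero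
  let b := (Pi.basisFun ℝ (Fin n)).ExteriorAlgebra.map (equivExterior Q).symm
  exact ⟨by rw [Module.finrank_eq_card_basis b]; simp, Module.Finite.of_basis b⟩

lemma sq_sum {n : ℕ} {A : Type} [Ring A] [Algebra ℝ A] (e : Fin n → A) (c : Fin n → ℝ)
    (h1 : ∀ i, e i * e i = algebraMap ℝ A (c i))
    (h2 : ∀ i j, i ≠ j → e i * e j = -(e j * e i)) (x : Fin n → ℝ) :
    (∑ i, x i • e i) * (∑ i, x i • e i) = algebraMap ℝ A (∑ i, c i * (x i * x i)) := by
  have key : (2 : ℝ) • ((∑ i, x i • e i) * (∑ i, x i • e i)) =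
      (2 : ℝ) • algebraMap ℝ A (∑ i, c i * (x i * x i)) := by
    rw [two_smul, Finset.sum_mul_sum]
    nth_rewrite 2 [Finset.sum_comm]
    rw [← Finset.sum_add_distrib, map_sum, Finset.smul_sum]
    refine Finset.sum_congr rfl fun i _ => ?_
    rw [← Finset.sum_add_distrib, Finset.sum_eq_single i]
    · rw [smul_mul_smul_comm, h1, two_smul, mul_comm (c i), map_mul, Algebra.smul_def]
    · intro j _ hj
      rw [smul_mul_smul_comm, smul_mul_smul_comm, h2 i j hj.symm, mul_comm (x j)]
      simp
    · simp
  exact smul_right_injective A (two_ne_zero : (2 : ℝ) ≠ 0) key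

lemma main {p q k : ℕ} (hk : p + q = 2 * k + 1) (h : Rep (wt p q) (MM k)) :
    Nonempty (CliffordAlgebra (Qpq p q) ≃ₐ[ℝ] MM k) := by
  have h' : Rep (fun i : Fin (p + q) => decide ((i : ℕ) < p)) (MM k) := by
    refine h.reindex finSumFinEquiv.symm fun i => ?_
    obtain ⟨j, rfl⟩ := finSumFinEquiv.surjective i
    rcases j with j | j <;> simp [wt]
  obtain ⟨e, h1, h2, h3⟩ := h'
  let f : (Fin (p + q) → ℝ) →ₗ[ℝ] MM k := Fintype.linearCombination ℝ e
  have hf : ∀ x, f x * f x = algebraMap ℝ _ (Qpq p q x) := by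
    intro x
    simp only [f, Fintype.linearCombination_apply]
    rw [sq_sum e (fun i : Fin (p + q) => if (i : ℕ) < p then (1 : ℝ) else -1) _ h2]
    · simp [Qpq, QuadraticMap.weightedSumSquares_apply]
    · intro i
      rw [h1]
      by_cases hi : (i : ℕ) < p
      · simp only [hi, decide_true, if_true, map_one]
      · simp [hi, -Prod.algebraMap_apply]
  let F : CliffordAlgebra (Qpq p q) →ₐ[ℝ] MM k := CliffordAlgebra.lift _ ⟨f, hf⟩
  have hs : Function.Surjective F := by
    rw [← AlgHom.range_eq_top, eq_top_iff, ← h3, Algebra.adjoin_le_iff]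
    rintro _ ⟨i, rfl⟩
    refine ⟨CliffordAlgebra.ι _ (Pi.single i 1), ?_⟩
    change F _ = _
    rw [CliffordAlgebra.lift_ι_apply]
    simp [f, Fintype.linearCombination_apply_single]
  obtain ⟨hr, hfin⟩ := finrank_cl (Qpq p q)
  have hr2 : Module.finrank ℝ (CliffordAlgebra (Qpq p q)) = Module.finrank ℝ (MM k) := by
    rw [hr, hk, Module.finrank_prod, Module.finrank_matrix]
    simp
    ring
  have hi : Function.Injective F :=
    (LinearMap.injective_iff_surjective_of_finrank_eq_finrank (f := F.toLinearMap) hr2).2 hs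
  exact ⟨AlgEquiv.ofBijective F ⟨hi, hs⟩⟩

end ClAux

/-- For `n = p + q` odd with `p − q ≡ 1 (mod 8)`, `Cl(p,q) ≅ M_{2^{(n−1)/2}}(ℝ) × M_{2^{(n−1)/2}}(ℝ)`. -/
theorem clpq_odd_1_iso_two_matrix_real (p q : ℕ) (hn : Odd (p + q))
    (h : (p : ℤ) - q ≡ 1 [ZMOD 8]) :
    Nonempty (CliffordAlgebra (Qpq p q) ≃ₐ[ℝ]
      (Matrix (Fin (2 ^ ((p + q - 1) / 2))) (Fin (2 ^ ((p + q - 1) / 2))) ℝ ×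
        Matrix (Fin (2 ^ ((p + q - 1) / 2))) (Fin (2 ^ ((p + q - 1) / 2))) ℝ)) := by
  obtain ⟨m, hm⟩ := hn
  have hk : (p + q - 1) / 2 = m := by omega
  rw [hk]
  refine ClAux.main hm ?_
  have hd := ClAux.diag m
  obtain ⟨c, hc⟩ := h.symm.dvd
  rcases le_total 0 c with h0 | h0
  · lift c to ℕ using h0
    obtain rfl : p = m + 1 + 4 * c := by omega
    obtain rfl : m = q + 4 * c := by omega
    exact ClAux.ups c hd
  · obtain ⟨d, rfl⟩ : ∃ d : ℕ, c = -d := ⟨c.natAbs, by omega⟩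
    obtain rfl : q = m + 4 * d := by omega
    have h1 : m + 1 = p + 4 * d := by omega
    rw [h1] at hd
    exact ClAux.downs d hd
end

section
/- Let p, q be natural numbers with n = p + q odd. If p − q ≡ 3 (mod 8) or p − q ≡ 7 (mod 8), then the Clifford algebra Cl(p,q) is isomorphic as an ℝ-algebra to the complex matrix algebra M_{2^{(n−1)/2}}(ℂ) of size 2^{(n−1)/2} (viewed as an ℝ-algebra). -/
open Quaternion Matrix CliffordAlgebra

/-- A system of `2m+1` complex gamma matrices in a complex algebra. -/
structure IsGamma (m : ℕ) (A : Type) [Ring A] [Algebra ℂ A] (Γ : ℕ → A) : Prop where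
  sq : ∀ i < 2 * m + 1, Γ i * Γ i = 1
  anti : ∀ i < 2 * m + 1, ∀ j < 2 * m + 1, i ≠ j → Γ i * Γ j = -(Γ j * Γ i)
  gen : ∀ S : Subalgebra ℂ A, (∀ i < 2 * m + 1, Γ i ∈ S) → S = ⊤
  prod : ((List.range (2 * m + 1)).map Γ).prod = algebraMap ℂ A (Complex.I ^ m)

theorem IsGamma.map {m : ℕ} {A B : Type} [Ring A] [Algebra ℂ A] [Ring B] [Algebra ℂ B]
    {Γ : ℕ → A} (h : IsGamma m A Γ) (e : A ≃ₐ[ℂ] B) : IsGamma m B (fun i => e (Γ i)) where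
  sq i hi := by rw [← map_mul, h.sq i hi, map_one]
  anti i hi j hj hij := by rw [← map_mul, h.anti i hi j hj hij, map_neg, map_mul]
  gen S hS := by
    have h1 := h.gen (S.comap (e : A →ₐ[ℂ] B)) (fun i hi => hS i hi)
    rw [eq_top_iff]
    intro x _
    have h2 : e.symm x ∈ S.comap (e : A →ₐ[ℂ] B) := by rw [h1]; trivial
    simpa using h2
  prod := by
    have := congrArg e h.prod
    rw [map_list_prod, List.map_map, AlgEquiv.commutes] at this
    exact this

/-- The gamma matrices in the next dimension. -/
noncomputable def nextGamma (m : ℕ) {A : Type} [Ring A] [Algebra ℂ A] (Γ : ℕ → A) (i : ℕ) :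
    Matrix (Fin 2) (Fin 2) A :=
  if i < 2 * m + 1 then !![0, Γ i; Γ i, 0]
  else if i = 2 * m + 1 then
    !![0, -algebraMap ℂ A Complex.I; algebraMap ℂ A Complex.I, 0]
  else !![1, 0; 0, -1]

theorem prod_nextGamma (m : ℕ) {A : Type} [Ring A] [Algebra ℂ A] (Γ : ℕ → A) (k : ℕ)
    (hk : 2 * k + 1 ≤ 2 * m + 1) :
    ((List.range (2 * k + 1)).map (nextGamma m Γ)).prod =
      !![0, ((List.range (2 * k + 1)).map Γ).prod; ((List.range (2 * k + 1)).map Γ).prod, 0] := by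
  induction k with
  | zero => simp [nextGamma]
  | succ k ih =>
    have e : 2 * (k + 1) + 1 = 2 * k + 1 + 1 + 1 := by ring
    rw [e, List.prod_range_succ _ (2 * k + 1 + 1), List.prod_range_succ _ (2 * k + 1),
      ih (by omega), List.prod_range_succ Γ (2 * k + 1 + 1), List.prod_range_succ Γ (2 * k + 1),
      nextGamma, nextGamma, if_pos (by omega), if_pos (by omega)]
    generalize ((List.range (2 * k + 1)).map Γ).prod = P
    simp

theorem IsGamma.next {m : ℕ} {A : Type} [Ring A] [Algebra ℂ A]
    {Γ : ℕ → A} (h : IsGamma m A Γ) :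
    IsGamma (m + 1) (Matrix (Fin 2) (Fin 2) A) (nextGamma m Γ) where
  sq i hi := by
    have hI : algebraMap ℂ A Complex.I * algebraMap ℂ A Complex.I = -1 := by
      rw [← map_mul, Complex.I_mul_I, map_neg, map_one]
    unfold nextGamma
    split_ifs with h1 h2
    · simp [h.sq i h1, Matrix.one_fin_two]
    · simp [Algebra.smul_def (A := A), hI, Matrix.one_fin_two]
    · simp [Matrix.one_fin_two]
  anti i hi j hj hij := by
    have hc : ∀ x, algebraMap ℂ A Complex.I * x = x * algebraMap ℂ A Complex.I :=
      fun x => Algebra.commutes _ _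
    unfold nextGamma
    split_ifs with h1 h2 h3 h4 h5 h6 h7 h8
    all_goals first
      | omega
      | (simp [Algebra.smul_def (A := A), hc]; done)
      | (simp [h.anti i (by assumption) j (by assumption) hij])
  gen S hS := by
    have h2 : nextGamma m Γ (2 * m + 1) ∈ S := hS _ (by omega)
    have h3 : nextGamma m Γ (2 * m + 2) ∈ S := hS _ (by omega)
    rw [nextGamma, if_neg (by omega), if_pos rfl] at h2
    rw [nextGamma, if_neg (by omega), if_neg (by omega)] at h3
    have hI : algebraMap ℂ A Complex.I * algebraMap ℂ A Complex.I = -1 := by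
      rw [← map_mul, Complex.I_mul_I, map_neg, map_one]
    have half : ∀ x : A, (2⁻¹ : ℂ) • (x + x) = x := fun x => by
      rw [← two_smul ℂ x, smul_smul]; norm_num
    have E00 : (!![1, 0; 0, 0] : Matrix (Fin 2) (Fin 2) A) ∈ S := by
      have := S.smul_mem (S.add_mem S.one_mem h3) (2⁻¹ : ℂ)
      convert this using 1
      ext i j
      fin_cases i <;> fin_cases j <;> simp [half]
    have E11 : (!![0, 0; 0, 1] : Matrix (Fin 2) (Fin 2) A) ∈ S := by
      have := S.sub_mem S.one_mem E00
      convert this using 1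
      ext i j
      fin_cases i <;> fin_cases j <;> simp
    have E01 : (!![0, 1; 0, 0] : Matrix (Fin 2) (Fin 2) A) ∈ S := by
      have := S.smul_mem (S.mul_mem E00 h2) Complex.I
      convert this using 1
      ext i j
      fin_cases i <;> fin_cases j <;> simp [Algebra.smul_def, hI]
    have E10 : (!![0, 0; 1, 0] : Matrix (Fin 2) (Fin 2) A) ∈ S := by
      have := S.smul_mem (S.mul_mem E11 h2) (-Complex.I)
      convert this using 1
      ext i j
      fin_cases i <;> fin_cases j <;> simp [Algebra.smul_def, hI]
    have hs := h.gen (S.comap (Matrix.scalarAlgHom (Fin 2) ℂ)) (by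
      intro i hi
      have h1 := hS i (by omega)
      rw [nextGamma, if_pos hi] at h1
      have := S.mul_mem h1 (S.add_mem E01 E10)
      rw [Subalgebra.mem_comap]
      convert this using 1
      ext i j
      fin_cases i <;> fin_cases j <;> simp)
    have hs' : ∀ a : A, (!![a, 0; 0, a] : Matrix (Fin 2) (Fin 2) A) ∈ S := by
      intro a
      have : a ∈ S.comap (Matrix.scalarAlgHom (Fin 2) ℂ) := by rw [hs]; trivial
      rw [Subalgebra.mem_comap] at this
      convert this using 1
      ext i j
      fin_cases i <;> fin_cases j <;> simp
    rw [eq_top_iff]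
    intro M _
    have := S.add_mem (S.add_mem (S.mul_mem (hs' (M 0 0)) E00) (S.mul_mem (hs' (M 0 1)) E01))
      (S.add_mem (S.mul_mem (hs' (M 1 0)) E10) (S.mul_mem (hs' (M 1 1)) E11))
    convert this using 1
    ext i j
    fin_cases i <;> fin_cases j <;> simp
  prod := by
    have e : 2 * (m + 1) + 1 = 2 * m + 1 + 1 + 1 := by ring
    rw [e, List.prod_range_succ, List.prod_range_succ, prod_nextGamma m Γ m le_rfl, h.prod,
      nextGamma, nextGamma, if_neg (by omega), if_pos rfl, if_neg (by omega), if_neg (by omega)]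
    ext i j
    fin_cases i <;> fin_cases j <;> simp [Matrix.algebraMap_matrix_apply, pow_succ]

theorem exists_gamma (m : ℕ) :
    ∃ Γ, IsGamma m (Matrix (Fin (2 ^ m)) (Fin (2 ^ m)) ℂ) Γ := by
  induction m with
  | zero =>
    refine ⟨fun _ => 1, ⟨by simp, by omega, ?_, by simp⟩⟩
    intro S _
    rw [eq_top_iff]
    intro M _
    have := S.algebraMap_mem (M 0 0)
    convert this using 1
    ext i j
    obtain rfl : i = 0 := Subsingleton.elim (α := Fin 1) _ _
    obtain rfl : j = 0 := Subsingleton.elim (α := Fin 1) _ _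
    simp [Matrix.algebraMap_matrix_apply]
  | succ m ih =>
    obtain ⟨Γ, h⟩ := ih
    have e : Fin 2 × Fin (2 ^ m) ≃ Fin (2 ^ (m + 1)) :=
      finProdFinEquiv.trans (finCongr (by ring))
    exact ⟨_, h.next.map ((Matrix.compAlgEquiv (Fin 2) (Fin (2 ^ m)) ℂ ℂ).trans
      (Matrix.reindexAlgEquiv ℂ ℂ e))⟩

theorem prod_smul_range {A : Type} [Ring A] [Algebra ℂ A] (s : ℕ → ℂ) (Γ : ℕ → A) (k : ℕ) :
    ((List.range k).map (fun i => s i • Γ i)).prod =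
      (∏ i ∈ Finset.range k, s i) • ((List.range k).map Γ).prod := by
  induction k with
  | zero => simp
  | succ k ih =>
    rw [List.prod_range_succ, List.prod_range_succ, ih, Finset.prod_range_succ, smul_mul_smul_comm]

theorem prod_signs (p q : ℕ) :
    ∏ i ∈ Finset.range (p + q), (if i < p then (1 : ℂ) else Complex.I) = Complex.I ^ q := by
  rw [Finset.prod_range_add]
  rw [Finset.prod_congr rfl (g := fun _ => (1 : ℂ))]
  · simp
  · intro i hi
    rw [if_pos (Finset.mem_range.1 hi)]

attribute [local instance] Algebra.toModule in
theorem exists_surj (p q m : ℕ) (hm : p + q = 2 * m + 1) (hodd : Odd (q + m))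
    {A : Type} [Ring A] [Algebra ℂ A] [Algebra ℝ A] [IsScalarTower ℝ ℂ A]
    {Γ : ℕ → A} (h : IsGamma m A Γ) :
    ∃ f : CliffordAlgebra (Qpq p q) →ₐ[ℝ] A, Function.Surjective f := by
  let s : ℕ → ℂ := fun i => if i < p then 1 else Complex.I
  let γ : ℕ → A := fun i => s i • Γ i
  let ε : ℕ → ℝ := fun i => if i < p then 1 else -1
  have hs : ∀ i, s i * s i = algebraMap ℝ ℂ (ε i) := by
    intro i
    simp only [s, ε]
    split_ifs <;> simp
  have hsq : ∀ i < 2 * m + 1, γ i * γ i = algebraMap ℝ A (ε i) := by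
    intro i hi
    simp only [γ]
    rw [smul_mul_smul_comm, h.sq i hi, hs, IsScalarTower.algebraMap_apply ℝ ℂ A,
      Algebra.algebraMap_eq_smul_one (A := A)]
  have hanti : ∀ i < 2 * m + 1, ∀ j < 2 * m + 1, i ≠ j → γ i * γ j + γ j * γ i = 0 := by
    intro i hi j hj hij
    simp only [γ]
    rw [smul_mul_smul_comm, smul_mul_smul_comm, h.anti i hi j hj hij, mul_comm (s j), smul_neg,
      neg_add_cancel]
  let g : (Fin (p + q) → ℝ) →ₗ[ℝ] A := Fintype.linearCombination ℝ (fun i : Fin (p + q) => γ i)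
  have hg : ∀ v, g v * g v = algebraMap ℝ A (Qpq p q v) := by
    intro v
    have h1 : g v * g v = ∑ i : Fin (p + q), ∑ j : Fin (p + q), (v i * v j) • (γ i * γ j) := by
      rw [Fintype.linearCombination_apply, Finset.sum_mul_sum]
      refine Finset.sum_congr rfl fun i _ => Finset.sum_congr rfl fun j _ => ?_
      rw [smul_mul_smul_comm]
    have h2 : g v * g v = ∑ i : Fin (p + q), ∑ j : Fin (p + q), (v i * v j) • (γ j * γ i) := by
      rw [h1, Finset.sum_comm]
      refine Finset.sum_congr rfl fun i _ => Finset.sum_congr rfl fun j _ => ?_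
      rw [mul_comm (v j)]
    have h3 : (2 : ℝ) • (g v * g v) = (2 : ℝ) • algebraMap ℝ A (Qpq p q v) := by
      rw [two_smul]
      nth_rewrite 1 [h1]
      rw [h2, ← Finset.sum_add_distrib, Qpq, QuadraticMap.weightedSumSquares_apply, map_sum,
        Finset.smul_sum]
      refine Finset.sum_congr rfl fun i _ => ?_
      rw [← Finset.sum_add_distrib, Finset.sum_eq_single i]
      · rw [← two_smul ℝ, hsq _ (hm ▸ i.2), smul_eq_mul, mul_comm, map_mul,
          Algebra.smul_def (v i * v i)]
        rw [Algebra.commutes]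
      · intro j _ hj
        rw [← smul_add, hanti _ (hm ▸ i.2) _ (hm ▸ j.2) (fun e => hj (Fin.ext e.symm)), smul_zero]
      · simp
    exact smul_right_injective A (two_ne_zero (α := ℝ)) h3
  refine ⟨CliffordAlgebra.lift (Qpq p q) ⟨g, hg⟩, ?_⟩
  set F := CliffordAlgebra.lift (Qpq p q) ⟨g, hg⟩ with hF
  have hγ : ∀ i < 2 * m + 1, γ i ∈ F.range := by
    intro i hi
    refine ⟨CliffordAlgebra.ι (Qpq p q) (Pi.single ⟨i, hm ▸ hi⟩ 1), ?_⟩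
    change F _ = _
    rw [hF, CliffordAlgebra.lift_ι_apply]
    simp [g, Fintype.linearCombination_apply_single]
  have hω : algebraMap ℂ A (Complex.I ^ (q + m)) ∈ F.range := by
    have h1 : ((List.range (2 * m + 1)).map γ).prod ∈ F.range := by
      apply Subalgebra.list_prod_mem
      intro x hx
      obtain ⟨i, hi, rfl⟩ := List.mem_map.1 hx
      exact hγ i (List.mem_range.1 hi)
    rw [prod_smul_range s Γ, h.prod, ← hm, prod_signs, Algebra.smul_def, ← map_mul, ← pow_add] at h1
    exact h1
  have hI : algebraMap ℂ A Complex.I ∈ F.range := by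
    obtain ⟨k, hk⟩ := hodd
    rw [hk, pow_succ, pow_mul, Complex.I_sq] at hω
    rcases neg_one_pow_eq_or ℂ k with e | e <;> rw [e] at hω
    · simpa using hω
    · simpa using hω
  have hC : ∀ z : ℂ, algebraMap ℂ A z ∈ F.range := by
    intro z
    rw [← Complex.re_add_im z, map_add, map_mul]
    refine add_mem ?_ (mul_mem ?_ hI)
    · exact (IsScalarTower.algebraMap_apply ℝ ℂ A z.re) ▸ F.range.algebraMap_mem z.re
    · exact (IsScalarTower.algebraMap_apply ℝ ℂ A z.im) ▸ F.range.algebraMap_mem z.im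
  let S : Subalgebra ℂ A := { F.range.toSubsemiring with algebraMap_mem' := hC }
  have hS : S = ⊤ := by
    apply h.gen
    intro i hi
    change Γ i ∈ F.range
    have h0 : s i ≠ 0 := by simp only [s]; split_ifs <;> simp
    have : Γ i = algebraMap ℂ A (s i)⁻¹ * γ i := by
      simp only [γ]
      rw [← Algebra.smul_def, smul_smul, inv_mul_cancel₀ h0, one_smul]
    rw [this]
    exact mul_mem (hC _) (hγ i hi)
  intro x
  have : x ∈ S := by rw [hS]; trivial
  exact this

/-- For `n = p + q` odd with `p − q ≡ 3, 7 (mod 8)`, `Cl(p,q) ≅ M_{2^{(n−1)/2}}(ℂ)` as ℝ-algebras. -/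
theorem clpq_odd_37_iso_matrix_complex (p q : ℕ) (hn : Odd (p + q))
    (h : (p : ℤ) - q ≡ 3 [ZMOD 8] ∨ (p : ℤ) - q ≡ 7 [ZMOD 8]) :
    Nonempty (CliffordAlgebra (Qpq p q) ≃ₐ[ℝ]
      (Matrix (Fin (2 ^ ((p + q - 1) / 2))) (Fin (2 ^ ((p + q - 1) / 2))) ℂ)) := by
  obtain ⟨m, hm⟩ := hn
  have hm' : (p + q - 1) / 2 = m := by omega
  rw [hm']
  have hodd : Odd (q + m) := by
    rw [Nat.odd_iff]
    unfold Int.ModEq at h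
    omega
  obtain ⟨Γ, hΓ⟩ := exists_gamma m
  obtain ⟨f, hf⟩ := exists_surj p q m hm hodd hΓ
  let b := (Module.Basis.ExteriorAlgebra (Pi.basisFun ℝ (Fin (p + q)))).map
    (CliffordAlgebra.equivExterior (Qpq p q)).symm
  have hfin : Module.Finite ℝ (CliffordAlgebra (Qpq p q)) := Module.Finite.of_basis b
  have h1 : Module.finrank ℝ (CliffordAlgebra (Qpq p q)) = 2 ^ (2 * m + 1) := by
    rw [Module.finrank_eq_card_basis b]
    simp [hm]
  have h2 : Module.finrank ℝ (Matrix (Fin (2 ^ m)) (Fin (2 ^ m)) ℂ) = 2 ^ (2 * m + 1) := by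
    rw [Module.finrank_matrix, Complex.finrank_real_complex]
    simp only [Fintype.card_fin]
    ring
  have hinj : Function.Injective f.toLinearMap :=
    (LinearMap.injective_iff_surjective_of_finrank_eq_finrank (h1.trans h2.symm)).2 hf
  exact ⟨AlgEquiv.ofBijective f ⟨hinj, hf⟩⟩
end
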